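/- arXiv:0908.1826 — 3 statements merged into one kernel-verified Lean document; each statement's English description precedes it below -/
import Mathlib

section
/- Let Φ be a real m × N matrix with restricted isometry constant δ_K for some integer K ≥ 1, and let S, T ⊆ {1, …, N} be disjoint index sets with |S ∪ T| ≤ K. Then the operator norm of the cross-Gram matrix satisfies ‖Φ_Sᵀ Φ_T‖₂ ≤ δ_K. In particular, for any single column index j ∉ S with |S| + 1 ≤ K, the row vector φ_jᵀ Φ_S satisfies ‖φ_jᵀ Φ_S‖₂ ≤ δ_K. -/
open Matrix BigOperators

/-- The submatrix of `Φ` consisting of the columns indexed by the finite set `S`. -/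
def colSub {m N : ℕ} (Φ : Matrix (Fin m) (Fin N) ℝ) (S : Finset (Fin N)) :
    Matrix (Fin m) {j // j ∈ S} ℝ :=
  Φ.submatrix id Subtype.val

/-- The operator norm of a real matrix induced by the Euclidean norms. -/
noncomputable def l2OpNorm {α β : Type*} [Fintype α] [Fintype β] [DecidableEq β]
    (M : Matrix α β ℝ) : ℝ :=
  ‖LinearMap.toContinuousLinearMap (Matrix.toEuclideanLin M)‖

/-- Polarization of the restricted isometry property: for vectors with disjoint supports,
the inner product of the images is small. -/
theorem sq_dotProduct_mulVec_le_of_rip {m N K : ℕ} {δ : ℝ} {Φ : Matrix (Fin m) (Fin N) ℝ}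
    (hRIP : ∀ (x : Fin N → ℝ) (T : Finset (Fin N)), T.card ≤ K →
      (∀ j ∉ T, x j = 0) →
      (1 - δ) * ∑ j, x j ^ 2 ≤ ∑ i, Φ.mulVec x i ^ 2 ∧
        ∑ i, Φ.mulVec x i ^ 2 ≤ (1 + δ) * ∑ j, x j ^ 2)
    {S T : Finset (Fin N)} (hdis : Disjoint S T) (hcard : (S ∪ T).card ≤ K)
    {u v : Fin N → ℝ} (hu : ∀ j ∉ S, u j = 0) (hv : ∀ j ∉ T, v j = 0) :
    (Φ *ᵥ u ⬝ᵥ Φ *ᵥ v) ^ 2 ≤ δ ^ 2 * ((∑ j, u j ^ 2) * ∑ j, v j ^ 2) := by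
  have orth : ∀ j, u j * v j = 0 := fun j => by
    by_cases hj : j ∈ S
    · rw [hv j (Finset.disjoint_left.mp hdis hj), mul_zero]
    · rw [hu j hj, zero_mul]
  have supp : ∀ t : ℝ, ∀ j ∉ S ∪ T, (t • u + v) j = 0 := fun t j hj => by
    rw [Finset.notMem_union] at hj
    simp [hu j hj.1, hv j hj.2]
  have norm_dom : ∀ t : ℝ,
      ∑ j, (t • u + v) j ^ 2 = t ^ 2 * ∑ j, u j ^ 2 + ∑ j, v j ^ 2 := fun t => by
    rw [Finset.mul_sum, ← Finset.sum_add_distrib]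
    refine Finset.sum_congr rfl fun j _ => ?_
    simp only [Pi.add_apply, Pi.smul_apply, smul_eq_mul]
    linear_combination 2 * t * orth j
  have norm_img : ∀ t : ℝ, ∑ i, (Φ *ᵥ (t • u + v)) i ^ 2 =
      t ^ 2 * ∑ i, (Φ *ᵥ u) i ^ 2 + 2 * t * (Φ *ᵥ u ⬝ᵥ Φ *ᵥ v) + ∑ i, (Φ *ᵥ v) i ^ 2 := fun t => by
    rw [dotProduct, Finset.mul_sum, Finset.mul_sum, ← Finset.sum_add_distrib,
      ← Finset.sum_add_distrib]
    refine Finset.sum_congr rfl fun i _ => ?_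
    simp only [mulVec_add, mulVec_smul, Pi.add_apply, Pi.smul_apply, smul_eq_mul]
    ring
  have hdisc := discrim_le_zero (a := δ * ∑ j, u j ^ 2) (b := -2 * (Φ *ᵥ u ⬝ᵥ Φ *ᵥ v))
    (c := δ * ∑ j, v j ^ 2) fun t => by
      have upper := (hRIP _ _ hcard (supp t)).2
      have lower := (hRIP _ _ hcard (supp (-t))).1
      rw [norm_dom, norm_img] at upper lower
      nlinarith
  rw [discrim] at hdisc
  nlinarith

/-- Under the restricted isometry property, the entries of `Φᵀ Φ v` outside the support of `v`
are small. -/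
theorem sum_sq_transpose_mulVec_le_of_rip {m N K : ℕ} {δ : ℝ} {Φ : Matrix (Fin m) (Fin N) ℝ}
    (hRIP : ∀ (x : Fin N → ℝ) (T : Finset (Fin N)), T.card ≤ K →
      (∀ j ∉ T, x j = 0) →
      (1 - δ) * ∑ j, x j ^ 2 ≤ ∑ i, Φ.mulVec x i ^ 2 ∧
        ∑ i, Φ.mulVec x i ^ 2 ≤ (1 + δ) * ∑ j, x j ^ 2)
    {S T : Finset (Fin N)} (hdis : Disjoint S T) (hcard : (S ∪ T).card ≤ K)
    {v : Fin N → ℝ} (hv : ∀ j ∉ T, v j = 0) :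
    ∑ s : {i // i ∈ S}, (Φᵀ *ᵥ (Φ *ᵥ v)) s ^ 2 ≤ δ ^ 2 * ∑ j, v j ^ 2 := by
  rw [Finset.sum_coe_sort S fun s => (Φᵀ *ᵥ (Φ *ᵥ v)) s ^ 2]
  set w := Φᵀ *ᵥ (Φ *ᵥ v) with hw
  set u : Fin N → ℝ := fun k => if k ∈ S then w k else 0 with hu
  have norm_u : ∑ k, u k ^ 2 = ∑ k ∈ S, w k ^ 2 := by
    simp [hu, ite_pow, Finset.sum_ite_mem]
  have inner_u : Φ *ᵥ u ⬝ᵥ Φ *ᵥ v = ∑ k ∈ S, w k ^ 2 := by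
    rw [dotProduct_comm, dotProduct_mulVec, ← mulVec_transpose, ← hw]
    simp [dotProduct, hu, Finset.sum_ite_mem, sq]
  have key := sq_dotProduct_mulVec_le_of_rip hRIP hdis hcard (u := u)
    (fun j hj => by simp [hu, hj]) hv
  rw [inner_u, norm_u] at key
  rcases (Finset.sum_nonneg fun k _ => sq_nonneg (w k) : 0 ≤ ∑ k ∈ S, w k ^ 2).eq_or_lt with h | h
  · rw [← h]
    positivity
  · refine le_of_mul_le_mul_left ?_ h
    linarith

/-- If `Φ` has restricted isometry constant `δ_K` and `S`, `T`
are disjoint index sets with `|S ∪ T| ≤ K`, then `‖Φ_Sᵀ Φ_T‖₂ ≤ δ_K`.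
In particular, for a single column index `j ∉ S` with `|S| + 1 ≤ K`,
`‖φ_jᵀ Φ_S‖₂ ≤ δ_K`. -/
theorem cross_gram_opNorm_le_ric {m N : ℕ} (K : ℕ) (hK : 1 ≤ K)
    (δ : ℝ) (hδ0 : 0 ≤ δ)
    (Φ : Matrix (Fin m) (Fin N) ℝ)
    (hRIP : ∀ (x : Fin N → ℝ) (T : Finset (Fin N)), T.card ≤ K →
      (∀ j ∉ T, x j = 0) →
      (1 - δ) * ∑ j, x j ^ 2 ≤ ∑ i, Φ.mulVec x i ^ 2 ∧
        ∑ i, Φ.mulVec x i ^ 2 ≤ (1 + δ) * ∑ j, x j ^ 2)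
    (S T : Finset (Fin N)) (hdis : Disjoint S T) (hcard : (S ∪ T).card ≤ K) :
    l2OpNorm ((colSub Φ S)ᵀ * colSub Φ T) ≤ δ ∧
    ∀ j : Fin N, j ∉ S → S.card + 1 ≤ K →
      Real.sqrt (∑ s : {i // i ∈ S}, (∑ i, Φ i j * Φ i s) ^ 2) ≤ δ := by
  refine ⟨?_, fun j hj hSj => ?_⟩
  · refine ContinuousLinearMap.opNorm_le_bound _ hδ0 fun x => ?_
    set v : Fin N → ℝ := fun k => if h : k ∈ T then x ⟨k, h⟩ else 0 with hv
    have sum_T : ∀ f : Fin N → ℝ → ℝ, (∀ k, f k 0 = 0) →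
        ∑ k, f k (v k) = ∑ t : {i // i ∈ T}, f t (x t) := fun f hf => by
      rw [← Finset.sum_subset (Finset.subset_univ T) fun k _ hk => by simp [hv, hk, hf],
        ← Finset.sum_coe_sort T fun k => f k (v k)]
      simp [hv]
    have norm_v : ∑ k, v k ^ 2 = ∑ t, x t ^ 2 := sum_T (fun _ y => y ^ 2) (by simp)
    have img_v : colSub Φ T *ᵥ x.ofLp = Φ *ᵥ v :=
      funext fun i => (sum_T (fun k y => Φ i k * y) (by simp)).symm
    have key := sum_sq_transpose_mulVec_le_of_rip hRIP hdis hcard (v := v)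
      fun k hk => by simp [hv, hk]
    rw [norm_v, ← img_v] at key
    rw [EuclideanSpace.norm_eq, EuclideanSpace.norm_eq]
    refine Real.sqrt_le_iff.mpr ⟨by positivity, ?_⟩
    rw [mul_pow, Real.sq_sqrt (by positivity)]
    simp only [Real.norm_eq_abs, sq_abs]
    convert key using 3 with s
    change (((colSub Φ S)ᵀ * colSub Φ T) *ᵥ x.ofLp) s = _
    rw [← mulVec_mulVec]
    rfl
  · have key := sum_sq_transpose_mulVec_le_of_rip hRIP (Finset.disjoint_singleton_right.mpr hj)
      ((Finset.card_union_le _ _).trans (by simpa using hSj)) (v := Pi.single j 1)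
      fun k hk => Pi.single_eq_of_ne (by simpa using hk) _
    refine Real.sqrt_le_iff.mpr ⟨hδ0, ?_⟩
    simpa [mulVec_single_one, mulVec, dotProduct, Pi.single_apply, mul_comm] using key
end

section
/- Let Φ be a real m × N matrix with restricted isometry constant δ_K < 1 for some integer K ≥ 1. Let S, T ⊆ {1, …, N} be disjoint index sets and j ∉ S ∪ T a column index, with |S ∪ T| ≤ K and |S| + 1 ≤ K. Then for every z ∈ ℝ^{|T|}, |φ_jᵀ Φ_S (Φ_SᵀΦ_S)⁻¹ Φ_Sᵀ Φ_T z| ≤ (δ_K² / (1−δ_K)) · ‖z‖₂. -/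
open Matrix BigOperators

/-- The vector on all column indices that agrees with `v` on `S` and vanishes off `S`. -/
def zeroExtend {N : ℕ} {S : Finset (Fin N)} (v : {i // i ∈ S} → ℝ) : Fin N → ℝ :=
  fun i => if h : i ∈ S then v ⟨i, h⟩ else 0

theorem zeroExtend_of_notMem {N : ℕ} {S : Finset (Fin N)} (v : {i // i ∈ S} → ℝ)
    {i : Fin N} (hi : i ∉ S) : zeroExtend v i = 0 := by
  simp [zeroExtend, hi]

theorem sum_mul_zeroExtend {N : ℕ} {S : Finset (Fin N)} (a : Fin N → ℝ)
    (v : {i // i ∈ S} → ℝ) : ∑ i, a i * zeroExtend v i = ∑ i : {i // i ∈ S}, a i * v i := by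
  rw [← Finset.sum_subset (Finset.subset_univ S)
    (fun i _ hi => by rw [zeroExtend_of_notMem v hi, mul_zero]), ← Finset.sum_coe_sort S]
  exact Finset.sum_congr rfl fun i _ => by simp [zeroExtend]

theorem zeroExtend_dotProduct_self {N : ℕ} {S : Finset (Fin N)} (v : {i // i ∈ S} → ℝ) :
    zeroExtend v ⬝ᵥ zeroExtend v = v ⬝ᵥ v := by
  rw [dotProduct, sum_mul_zeroExtend]
  exact Finset.sum_congr rfl fun i _ => by simp [zeroExtend]

theorem mulVec_zeroExtend {m N : ℕ} (Φ : Matrix (Fin m) (Fin N) ℝ) {S : Finset (Fin N)}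
    (v : {i // i ∈ S} → ℝ) : Φ *ᵥ zeroExtend v = colSub Φ S *ᵥ v := by
  ext i
  exact sum_mul_zeroExtend (Φ i) v

/-- Two-sided restricted isometry bounds for vectors supported on a fixed set `U` make the images
of orthogonal vectors supported on `U` almost orthogonal. -/
theorem abs_mulVec_dotProduct_mulVec_le {m N : ℕ} {δ : ℝ}
    {Φ : Matrix (Fin m) (Fin N) ℝ} {U : Finset (Fin N)}
    (hΦ : ∀ x : Fin N → ℝ, (∀ i ∉ U, x i = 0) →
      (1 - δ) * (x ⬝ᵥ x) ≤ (Φ *ᵥ x) ⬝ᵥ (Φ *ᵥ x) ∧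
        (Φ *ᵥ x) ⬝ᵥ (Φ *ᵥ x) ≤ (1 + δ) * (x ⬝ᵥ x))
    {x y : Fin N → ℝ} (hx : ∀ i ∉ U, x i = 0) (hy : ∀ i ∉ U, y i = 0) (hxy : x ⬝ᵥ y = 0) :
    |(Φ *ᵥ x) ⬝ᵥ (Φ *ᵥ y)| ≤ δ * √(x ⬝ᵥ x) * √(y ⬝ᵥ y) := by
  have hx0 : 0 ≤ x ⬝ᵥ x := Finset.sum_nonneg fun i _ => mul_self_nonneg (x i)
  have hy0 : 0 ≤ y ⬝ᵥ y := Finset.sum_nonneg fun i _ => mul_self_nonneg (y i)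
  have key : ∀ a b : ℝ, 2 * (a * b * ((Φ *ᵥ x) ⬝ᵥ (Φ *ᵥ y))) ≤
      δ * (a ^ 2 * (x ⬝ᵥ x) + b ^ 2 * (y ⬝ᵥ y)) := by
    intro a b
    have h1 := (hΦ (a • x + b • y) fun i hi => by simp [hx i hi, hy i hi]).2
    have h2 := (hΦ (a • x - b • y) fun i hi => by simp [hx i hi, hy i hi]).1
    simp only [mulVec_add, mulVec_sub, mulVec_smul, add_dotProduct, dotProduct_add,
      sub_dotProduct, dotProduct_sub, smul_dotProduct, dotProduct_smul, smul_eq_mul,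
      dotProduct_comm y x, hxy, dotProduct_comm (Φ *ᵥ y) (Φ *ᵥ x)] at h1 h2
    linarith
  rcases hx0.eq_or_lt with hx1 | hx1
  · simp [dotProduct_self_eq_zero.1 hx1.symm]
  rcases hy0.eq_or_lt with hy1 | hy1
  · simp [dotProduct_self_eq_zero.1 hy1.symm]
  have hp := Real.sqrt_pos.2 hx1
  have hq := Real.sqrt_pos.2 hy1
  have h1 := key √(y ⬝ᵥ y) √(x ⬝ᵥ x)
  have h2 := key √(y ⬝ᵥ y) (-√(x ⬝ᵥ x))
  have ex := Real.sq_sqrt hx0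
  have ey := Real.sq_sqrt hy0
  set p := √(x ⬝ᵥ x)
  set q := √(y ⬝ᵥ y)
  rw [← ex, ← ey] at h1 h2
  have hpq : 0 < q * p := mul_pos hq hp
  rw [abs_le]
  constructor <;> refine le_of_mul_le_mul_left ?_ hpq <;> linarith

/-- If `Φ` has restricted isometry constant `δ_K < 1`, `S` and
`T` are disjoint, `j ∉ S ∪ T`, `|S ∪ T| ≤ K` and `|S| + 1 ≤ K`, then for every
`z`, `|φ_jᵀ Φ_S (Φ_SᵀΦ_S)⁻¹ Φ_Sᵀ Φ_T z| ≤ (δ_K²/(1−δ_K)) ‖z‖₂`. -/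
theorem projected_cross_term_bound {m N : ℕ} (K : ℕ) (hK : 1 ≤ K)
    (δ : ℝ) (hδ0 : 0 ≤ δ) (hδ1 : δ < 1)
    (Φ : Matrix (Fin m) (Fin N) ℝ)
    (hRIP : ∀ (x : Fin N → ℝ) (T : Finset (Fin N)), T.card ≤ K →
      (∀ j ∉ T, x j = 0) →
      (1 - δ) * ∑ j, x j ^ 2 ≤ ∑ i, Φ.mulVec x i ^ 2 ∧
        ∑ i, Φ.mulVec x i ^ 2 ≤ (1 + δ) * ∑ j, x j ^ 2)
    (S T : Finset (Fin N)) (hdis : Disjoint S T)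
    (j : Fin N) (hj : j ∉ S ∪ T)
    (hcard : (S ∪ T).card ≤ K) (hcard' : S.card + 1 ≤ K) :
    ∀ z : {i // i ∈ T} → ℝ,
      |∑ i, Φ i j *
          (colSub Φ S * ((colSub Φ S)ᵀ * colSub Φ S)⁻¹ * (colSub Φ S)ᵀ
            * colSub Φ T).mulVec z i|
        ≤ δ ^ 2 / (1 - δ) * Real.sqrt (∑ t, z t ^ 2) := by
  intro z
  have hΦ : ∀ U : Finset (Fin N), U.card ≤ K → ∀ x : Fin N → ℝ, (∀ i ∉ U, x i = 0) →
      (1 - δ) * (x ⬝ᵥ x) ≤ (Φ *ᵥ x) ⬝ᵥ (Φ *ᵥ x) ∧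
        (Φ *ᵥ x) ⬝ᵥ (Φ *ᵥ x) ≤ (1 + δ) * (x ⬝ᵥ x) := by
    intro U hU x hx
    simpa only [dotProduct, pow_two] using hRIP x U hU hx
  have hlow : ∀ v : {i // i ∈ S} → ℝ,
      (1 - δ) * (v ⬝ᵥ v) ≤ (colSub Φ S *ᵥ v) ⬝ᵥ (colSub Φ S *ᵥ v) := by
    intro v
    have h := (hΦ S (by lia) (zeroExtend v) fun i hi => zeroExtend_of_notMem v hi).1
    rwa [zeroExtend_dotProduct_self, mulVec_zeroExtend] at h
  have hgram : ∀ (v : {i // i ∈ S} → ℝ) (u : Fin m → ℝ),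
      v ⬝ᵥ ((colSub Φ S)ᵀ *ᵥ u) = (colSub Φ S *ᵥ v) ⬝ᵥ u := by
    intro v u
    rw [dotProduct_mulVec, vecMul_transpose]
  have hunit : IsUnit ((colSub Φ S)ᵀ * colSub Φ S).det := by
    rw [isUnit_iff_ne_zero]
    intro hdet
    obtain ⟨v, hv0, hv⟩ := exists_mulVec_eq_zero_iff.2 hdet
    have h := hlow v
    rw [← hgram, mulVec_mulVec, hv, dotProduct_zero] at h
    have hvv : 0 ≤ v ⬝ᵥ v := Finset.sum_nonneg fun i _ => mul_self_nonneg (v i)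
    exact hv0 (dotProduct_self_eq_zero.1 (by nlinarith))
  set w := ((colSub Φ S)ᵀ * colSub Φ S)⁻¹ *ᵥ ((colSub Φ S)ᵀ *ᵥ (colSub Φ T *ᵥ z)) with hw
  have hnormal : (colSub Φ S)ᵀ *ᵥ (colSub Φ S *ᵥ w) = (colSub Φ S)ᵀ *ᵥ (colSub Φ T *ᵥ z) := by
    rw [mulVec_mulVec, hw, mulVec_mulVec, mul_nonsing_inv _ hunit, one_mulVec]
  have hexpr : (∑ i, Φ i j *
      (colSub Φ S * ((colSub Φ S)ᵀ * colSub Φ S)⁻¹ * (colSub Φ S)ᵀ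
        * colSub Φ T).mulVec z i) = (Φ *ᵥ Pi.single j 1) ⬝ᵥ (Φ *ᵥ zeroExtend w) := by
    rw [mulVec_zeroExtend, hw, mulVec_single_one]
    simp only [mulVec_mulVec, Matrix.mul_assoc]
    rfl
  have hjS : j ∉ S := fun h => hj (Finset.mem_union_left T h)
  have hcol : |(Φ *ᵥ Pi.single j 1) ⬝ᵥ (Φ *ᵥ zeroExtend w)| ≤ δ * √(w ⬝ᵥ w) := by
    have h := abs_mulVec_dotProduct_mulVec_le
      (hΦ (insert j S) ((Finset.card_insert_le j S).trans hcard'))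
      (x := Pi.single j 1) (y := zeroExtend w)
      (fun i hi => Pi.single_eq_of_ne (fun h => hi (by simp [h])) _)
      (fun i hi => zeroExtend_of_notMem w fun h => hi (Finset.mem_insert_of_mem h))
      (by simp [zeroExtend_of_notMem w hjS])
    simpa [zeroExtend_dotProduct_self] using h
  have hST : |(Φ *ᵥ zeroExtend w) ⬝ᵥ (Φ *ᵥ zeroExtend z)| ≤ δ * √(w ⬝ᵥ w) * √(z ⬝ᵥ z) := by
    have h := abs_mulVec_dotProduct_mulVec_le (hΦ (S ∪ T) hcard)
      (x := zeroExtend w) (y := zeroExtend z)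
      (fun i hi => zeroExtend_of_notMem w fun h => hi (Finset.mem_union_left T h))
      (fun i hi => zeroExtend_of_notMem z fun h => hi (Finset.mem_union_right S h))
      (Finset.sum_eq_zero fun i _ => by
        by_cases hi : i ∈ S
        · rw [zeroExtend_of_notMem z (Finset.disjoint_left.1 hdis hi), mul_zero]
        · rw [zeroExtend_of_notMem w hi, zero_mul])
    simpa only [zeroExtend_dotProduct_self] using h
  have hwz : (1 - δ) * √(w ⬝ᵥ w) ≤ δ * √(z ⬝ᵥ z) := by
    have hww : 0 ≤ w ⬝ᵥ w := Finset.sum_nonneg fun i _ => mul_self_nonneg (w i)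
    have h := hlow w
    rw [← hgram, hnormal, hgram, ← mulVec_zeroExtend, ← mulVec_zeroExtend] at h
    have h' := h.trans ((le_abs_self _).trans hST)
    rcases hww.eq_or_lt with h0 | h0
    · rw [← h0, Real.sqrt_zero, mul_zero]
      positivity
    · refine le_of_mul_le_mul_left ?_ (Real.sqrt_pos.2 h0)
      nlinarith [Real.sq_sqrt hww]
  have hz : ∑ t, z t ^ 2 = z ⬝ᵥ z := by simp only [dotProduct, pow_two]
  have hδ : 0 < 1 - δ := sub_pos.2 hδ1
  rw [hexpr, hz, div_mul_eq_mul_div, le_div_iff₀ hδ]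
  nlinarith [mul_le_mul_of_nonneg_right hcol hδ.le, mul_le_mul_of_nonneg_left hwz hδ0]
end

section
/- Let Φ be a real m × N matrix whose columns have unit Euclidean norm, with restricted isometry constant δ_K < 1 for an even integer K ≥ 2. Let S⁰ ⊆ {1, …, N} with |S⁰| ≤ K/2, let x⁰ ∈ ℝᴺ be supported on S⁰ with Φx⁰ = y⁰, and let y = y⁰ + n with ‖n‖₂ ≤ ε. Assume the dynamic-range condition min_{j ∈ S⁰} |x⁰_j| ≥ 2·( ε + (δ_K / (1−δ_K)) · √(K/2) · max_{j ∈ S⁰} |x⁰_j| ). Then for every proper subset S ⊊ S⁰ such that Φ_SᵀΦ_S is invertible, the residual r = Φ_S x_S − y of the least-squares estimate x_S = (Φ_SᵀΦ_S)⁻¹Φ_Sᵀy satisfies min_{j ∈ S⁰∖S} |φ_jᵀ r| ≥ max_{j ∉ S⁰} |φ_jᵀ r|; hence any index maximizing |φ_jᵀ r| over j ∉ S lies in S⁰, and the support of the AMOP solution remains contained in S⁰ throughout the iteration unless all coordinates of S⁰ have been chosen. -/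
open Matrix BigOperators

/-- The residual `r = Φ_S x_S − y` of the least-squares estimate
`x_S = (Φ_SᵀΦ_S)⁻¹ Φ_Sᵀ y` over the columns indexed by `S`. -/
noncomputable def lsResidual {m N : ℕ} (Φ : Matrix (Fin m) (Fin N) ℝ)
    (S : Finset (Fin N)) (y : Fin m → ℝ) : Fin m → ℝ :=
  (colSub Φ S).mulVec ((((colSub Φ S)ᵀ * colSub Φ S)⁻¹ * (colSub Φ S)ᵀ).mulVec y) - y

/-- `Q` is the orthogonal projection onto the complement of the span of the columns of `Φ`
indexed by `S`. -/
structure IsColCompl {m N : ℕ} (Φ : Matrix (Fin m) (Fin N) ℝ) (S : Finset (Fin N))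
    (Q : Matrix (Fin m) (Fin m) ℝ) : Prop where
  symm : Qᵀ = Q
  mulVec_eq_zero : ∀ x : Fin N → ℝ, (∀ j ∉ S, x j = 0) → Q *ᵥ (Φ *ᵥ x) = 0
  exists_eq_sub : ∀ v, ∃ w : Fin N → ℝ, (∀ j ∉ S, w j = 0) ∧ Q *ᵥ v = v - Φ *ᵥ w

/-- The restricted isometry property with constant `δ` on supports of size at most `K`. -/
def IsRIP {m N : ℕ} (Φ : Matrix (Fin m) (Fin N) ℝ) (K : ℕ) (δ : ℝ) : Prop :=
  ∀ (x : Fin N → ℝ) (T : Finset (Fin N)), T.card ≤ K → (∀ j ∉ T, x j = 0) →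
    (1 - δ) * (x ⬝ᵥ x) ≤ (Φ *ᵥ x) ⬝ᵥ (Φ *ᵥ x) ∧
      (Φ *ᵥ x) ⬝ᵥ (Φ *ᵥ x) ≤ (1 + δ) * (x ⬝ᵥ x)

theorem dotProduct_self_eq_sum_sq {n : ℕ} (v : Fin n → ℝ) : v ⬝ᵥ v = ∑ i, v i ^ 2 := by
  simp [dotProduct, sq]

theorem sq_dotProduct_le {n : ℕ} (v w : Fin n → ℝ) :
    (v ⬝ᵥ w) ^ 2 ≤ (v ⬝ᵥ v) * (w ⬝ᵥ w) := by
  rw [dotProduct_self_eq_sum_sq, dotProduct_self_eq_sum_sq]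
  exact Finset.sum_mul_sq_le_sq_mul_sq Finset.univ v w

theorem dotProduct_self_nonneg {n : ℕ} (v : Fin n → ℝ) : 0 ≤ v ⬝ᵥ v := by
  simpa using dotProduct_star_self_nonneg v

theorem dotProduct_eq_zero_of_disjoint_support {n : ℕ} {S : Finset (Fin n)} {v w : Fin n → ℝ}
    (hv : ∀ j ∈ S, v j = 0) (hw : ∀ j ∉ S, w j = 0) : v ⬝ᵥ w = 0 := by
  refine Finset.sum_eq_zero fun j _ => ?_
  by_cases h : j ∈ S
  · simp [hv j h]
  · simp [hw j h]

theorem colSub_mulVec {m N : ℕ} (Φ : Matrix (Fin m) (Fin N) ℝ) (S : Finset (Fin N))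
    (x : Fin N → ℝ) (hx : ∀ j ∉ S, x j = 0) :
    colSub Φ S *ᵥ (fun j => x j) = Φ *ᵥ x := by
  ext i
  simp only [mulVec, dotProduct, colSub, submatrix_apply, id]
  rw [Finset.sum_coe_sort S (fun j => Φ i j * x j)]
  exact Finset.sum_subset (Finset.subset_univ S) fun j _ hj => by simp [hx j hj]

theorem exists_isColCompl {m N : ℕ} (Φ : Matrix (Fin m) (Fin N) ℝ) (S : Finset (Fin N))
    (hdet : IsUnit ((colSub Φ S)ᵀ * colSub Φ S).det) :
    ∃ Q, IsColCompl Φ S Q ∧ ∀ y, lsResidual Φ S y = -(Q *ᵥ y) := by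
  set A := colSub Φ S with hA
  refine ⟨1 - A * ((Aᵀ * A)⁻¹ * Aᵀ), ⟨?_, fun x hx => ?_, fun v => ?_⟩, fun y => ?_⟩
  · simp [transpose_nonsing_inv, Matrix.mul_assoc]
  · rw [← colSub_mulVec Φ S x hx, ← hA, mulVec_mulVec, Matrix.sub_mul, Matrix.mul_assoc,
      Matrix.mul_assoc, nonsing_inv_mul _ hdet]
    simp
  · set z := ((Aᵀ * A)⁻¹ * Aᵀ) *ᵥ v with hz
    refine ⟨fun j => if h : j ∈ S then z ⟨j, h⟩ else 0, fun j hj => by simp [hj], ?_⟩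
    rw [← colSub_mulVec Φ S _ (fun j hj => by simp [hj]), sub_mulVec, one_mulVec,
      ← mulVec_mulVec, ← hz]
    congr 2
    ext j
    simp
  · rw [lsResidual, ← hA, sub_mulVec, one_mulVec, mulVec_mulVec, neg_sub]

namespace IsColCompl

variable {m N K : ℕ} {Φ : Matrix (Fin m) (Fin N) ℝ} {S : Finset (Fin N)}
  {Q : Matrix (Fin m) (Fin m) ℝ} {δ : ℝ}

theorem dotProduct_mulVec_comm (hQ : IsColCompl Φ S Q) (v w : Fin m → ℝ) :
    v ⬝ᵥ Q *ᵥ w = w ⬝ᵥ Q *ᵥ v := by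
  rw [dotProduct_mulVec, ← mulVec_transpose, hQ.symm, dotProduct_comm]

theorem mulVec_mulVec_self (hQ : IsColCompl Φ S Q) (v : Fin m → ℝ) :
    Q *ᵥ (Q *ᵥ v) = Q *ᵥ v := by
  obtain ⟨w, hw, h⟩ := hQ.exists_eq_sub v
  conv_lhs => rw [h, mulVec_sub, hQ.mulVec_eq_zero w hw, sub_zero]

theorem dotProduct_mulVec_mulVec (hQ : IsColCompl Φ S Q) (v w : Fin m → ℝ) :
    (Q *ᵥ v) ⬝ᵥ (Q *ᵥ w) = v ⬝ᵥ Q *ᵥ w := by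
  rw [dotProduct_comm, hQ.dotProduct_mulVec_comm, hQ.mulVec_mulVec_self]

theorem dotProduct_mulVec_self_le (hQ : IsColCompl Φ S Q) (v : Fin m → ℝ) :
    v ⬝ᵥ Q *ᵥ v ≤ v ⬝ᵥ v := by
  have h := dotProduct_self_nonneg (v - Q *ᵥ v)
  simp only [sub_dotProduct, dotProduct_sub, hQ.dotProduct_mulVec_mulVec,
    dotProduct_comm (Q *ᵥ v) v] at h
  linarith

/-- The projected matrix `Q * Φ` inherits the restricted isometry bounds off `S`. -/
theorem quadratic_bounds (hQ : IsColCompl Φ S Q) (hRIP : IsRIP Φ K δ) (hδ : δ < 1)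
    {T : Finset (Fin N)} (hT : (T ∪ S).card ≤ K) {a : Fin N → ℝ}
    (haT : ∀ j ∉ T, a j = 0) (haS : ∀ j ∈ S, a j = 0) :
    (1 - δ) * (a ⬝ᵥ a) ≤ (Φ *ᵥ a) ⬝ᵥ Q *ᵥ (Φ *ᵥ a) ∧
      (Φ *ᵥ a) ⬝ᵥ Q *ᵥ (Φ *ᵥ a) ≤ (1 + δ) * (a ⬝ᵥ a) := by
  constructor
  · obtain ⟨w, hw, h⟩ := hQ.exists_eq_sub (Φ *ᵥ a)
    have h0 := (hRIP (a - w) (T ∪ S) hT fun j hj => by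
      simp only [Finset.mem_union, not_or] at hj
      simp [haT j hj.1, hw j hj.2]).1
    have hcross := dotProduct_eq_zero_of_disjoint_support haS hw
    rw [mulVec_sub, ← h, hQ.dotProduct_mulVec_mulVec] at h0
    simp only [sub_dotProduct, dotProduct_sub, dotProduct_comm w a, hcross] at h0
    nlinarith [dotProduct_self_nonneg w]
  · exact (hQ.dotProduct_mulVec_self_le _).trans (hRIP a (T ∪ S) hT fun j hj =>
      haT j fun h => hj (Finset.mem_union_left _ h)).2

/-- Near-orthogonality of projected images of orthogonal sparse vectors. -/
theorem sq_bilin_le (hQ : IsColCompl Φ S Q) (hRIP : IsRIP Φ K δ) (hδ : δ < 1)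
    {T : Finset (Fin N)} (hT : (T ∪ S).card ≤ K) {a b : Fin N → ℝ}
    (haT : ∀ j ∉ T, a j = 0) (haS : ∀ j ∈ S, a j = 0)
    (hbT : ∀ j ∉ T, b j = 0) (hbS : ∀ j ∈ S, b j = 0) (hab : a ⬝ᵥ b = 0) :
    ((Φ *ᵥ a) ⬝ᵥ Q *ᵥ (Φ *ᵥ b)) ^ 2 ≤ δ ^ 2 * ((a ⬝ᵥ a) * (b ⬝ᵥ b)) := by
  set q := (Φ *ᵥ a) ⬝ᵥ Q *ᵥ (Φ *ᵥ b) with hq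
  have key : ∀ t : ℝ, 0 ≤ (δ * (b ⬝ᵥ b)) * (t * t) + (-2 * q) * t + δ * (a ⬝ᵥ a) := by
    intro t
    have h1 := (hQ.quadratic_bounds hRIP hδ hT (a := a + t • b)
      (fun j hj => by simp [haT j hj, hbT j hj]) (fun j hj => by simp [haS j hj, hbS j hj])).2
    have h2 := (hQ.quadratic_bounds hRIP hδ hT (a := a - t • b)
      (fun j hj => by simp [haT j hj, hbT j hj]) (fun j hj => by simp [haS j hj, hbS j hj])).1
    have hcomm := hQ.dotProduct_mulVec_comm (Φ *ᵥ b) (Φ *ᵥ a)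
    simp only [mulVec_add, mulVec_sub, mulVec_smul, add_dotProduct, dotProduct_add,
      sub_dotProduct, dotProduct_sub, smul_dotProduct, dotProduct_smul, smul_eq_mul,
      dotProduct_comm b a, hab, hcomm, ← hq] at h1 h2
    linarith
  have hd := discrim_le_zero key
  rw [discrim] at hd
  linarith

/-- Projecting a unit-norm column away from the other columns of a sparse set keeps at least
`1 - δ ^ 2` of its squared norm. -/
theorem one_sub_sq_le (hQ : IsColCompl Φ S Q) (hRIP : IsRIP Φ K δ)
    (hδ0 : 0 ≤ δ) (hδ1 : δ < 1)
    {j : Fin N} (hj : j ∉ S) (hT : ({j} ∪ S).card ≤ K)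
    (hcol : (Φ *ᵥ Pi.single j 1) ⬝ᵥ (Φ *ᵥ Pi.single j 1) = 1) :
    1 - δ ^ 2 ≤ (Φ *ᵥ Pi.single j 1) ⬝ᵥ Q *ᵥ (Φ *ᵥ Pi.single j 1) := by
  set e : Fin N → ℝ := Pi.single j 1 with he
  obtain ⟨w, hw, h⟩ := hQ.exists_eq_sub (Φ *ᵥ e)
  have hΦw : Φ *ᵥ w = Φ *ᵥ e - Q *ᵥ (Φ *ᵥ e) := by rw [h]; abel
  have hee : e ⬝ᵥ e = 1 := by simp [he]
  have hew : e ⬝ᵥ w = 0 := by simp [he, hw j hj]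
  set q := (Φ *ᵥ e) ⬝ᵥ Q *ᵥ (Φ *ᵥ e) with hq
  have hsupp : ∀ t : ℝ, ∀ i ∉ ({j} ∪ S : Finset (Fin N)), (t • e + w) i = 0 := by
    intro t i hi
    simp only [Finset.mem_union, Finset.mem_singleton, not_or] at hi
    simp [he, hi.1, hw i hi.2]
  have hnorm : ∀ t : ℝ, (t • e + w) ⬝ᵥ (t • e + w) = t ^ 2 + w ⬝ᵥ w := by
    intro t
    simp only [add_dotProduct, dotProduct_add, smul_dotProduct, dotProduct_smul, smul_eq_mul,
      dotProduct_comm w e, hew, hee]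
    ring
  have himg : ∀ t : ℝ, (Φ *ᵥ (t • e + w)) ⬝ᵥ (Φ *ᵥ (t • e + w))
      = t ^ 2 + 2 * t * (1 - q) + (1 - q) := by
    intro t
    simp only [mulVec_add, mulVec_smul, hΦw, add_dotProduct, dotProduct_add, sub_dotProduct,
      dotProduct_sub, smul_dotProduct, dotProduct_smul, smul_eq_mul,
      hQ.dotProduct_mulVec_mulVec, dotProduct_comm (Q *ᵥ (Φ *ᵥ e)) (Φ *ᵥ e), hcol, ← hq]
    ring
  have hlo := fun t : ℝ => (hRIP _ _ hT (hsupp t)).1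
  have hup := (hRIP _ _ hT (hsupp δ)).2
  simp only [hnorm, himg] at hlo hup
  have hww := dotProduct_self_nonneg w
  rcases hδ0.eq_or_lt with rfl | hpos
  · nlinarith [hlo (-1)]
  · have h1 := hlo (-δ)
    have h2 : 0 ≤ 2 * δ * (δ ^ 2 - (1 - q)) := by nlinarith
    have h3 := nonneg_of_mul_nonneg_right h2 (by positivity)
    linarith

theorem abs_dotProduct_mulVec_le (hQ : IsColCompl Φ S Q) {v n : Fin m → ℝ} (hv : v ⬝ᵥ v = 1)
    {ε : ℝ} (hn : √(n ⬝ᵥ n) ≤ ε) : |v ⬝ᵥ Q *ᵥ n| ≤ ε := by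
  refine le_trans (Real.abs_le_sqrt ?_) hn
  have h1 := sq_dotProduct_le (Q *ᵥ v) n
  rw [hQ.dotProduct_mulVec_mulVec, dotProduct_comm, ← hQ.dotProduct_mulVec_comm v n] at h1
  have h2 := hQ.dotProduct_mulVec_self_le v
  nlinarith [dotProduct_self_nonneg n]

end IsColCompl

/-- **correct support selection for AMOP.** Under the RIP with
`δ_K < 1` (`K` even, `|S⁰| ≤ K/2`), unit-norm columns, noise of norm at most
`ε`, and the dynamic-range condition
`min_{j∈S⁰}|x⁰_j| ≥ 2(ε + (δ/(1−δ))√(K/2)·max_{j∈S⁰}|x⁰_j|)`,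
for every proper subset `S ⊊ S⁰` with invertible Gram matrix the least-squares
residual `r` satisfies `min_{j∈S⁰∖S} |φ_jᵀ r| ≥ max_{j∉S⁰} |φ_jᵀ r|`:
every correlation off the true support is dominated by every correlation on the
not-yet-identified part of the support. -/
theorem amop_selects_correct_support {m N : ℕ} (K : ℕ)
    (hKeven : Even K) (hK2 : 2 ≤ K)
    (δ : ℝ) (hδ0 : 0 ≤ δ) (hδ1 : δ < 1)
    (Φ : Matrix (Fin m) (Fin N) ℝ)
    (hcols : ∀ j, ∑ i, Φ i j ^ 2 = 1)
    (hRIP : ∀ (x : Fin N → ℝ) (T : Finset (Fin N)), T.card ≤ K →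
      (∀ j ∉ T, x j = 0) →
      (1 - δ) * ∑ j, x j ^ 2 ≤ ∑ i, Φ.mulVec x i ^ 2 ∧
        ∑ i, Φ.mulVec x i ^ 2 ≤ (1 + δ) * ∑ j, x j ^ 2)
    (S0 : Finset (Fin N)) (hne : S0.Nonempty) (hS0card : 2 * S0.card ≤ K)
    (x0 : Fin N → ℝ) (hsupp : ∀ j ∉ S0, x0 j = 0)
    (y0 y nv : Fin m → ℝ) (hy0 : Φ.mulVec x0 = y0) (hy : y = y0 + nv)
    (ε : ℝ) (hnoise : Real.sqrt (∑ i, nv i ^ 2) ≤ ε)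
    (hdyn : S0.inf' hne (fun j => |x0 j|)
      ≥ 2 * (ε + δ / (1 - δ) * Real.sqrt ((K : ℝ) / 2)
              * S0.sup' hne (fun j => |x0 j|))) :
    ∀ S : Finset (Fin N), S ⊂ S0 →
      IsUnit ((colSub Φ S)ᵀ * colSub Φ S).det →
      ∀ j ∈ S0 \ S, ∀ j' : Fin N, j' ∉ S0 →
        |∑ i, Φ i j' * lsResidual Φ S y i| ≤ |∑ i, Φ i j * lsResidual Φ S y i| := by
  intro S hSS hdet j hj j' hj'
  have hR : IsRIP Φ K δ := fun x T hT hx => by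
    simpa only [dotProduct_self_eq_sum_sq] using hRIP x T hT hx
  obtain ⟨Q, hQ, hres⟩ := exists_isColCompl Φ S hdet
  obtain ⟨hj0, hjS⟩ := Finset.mem_sdiff.1 hj
  have hj'S : j' ∉ S := fun h => hj' (hSS.1 h)
  have hcol : ∀ c, (Φ *ᵥ Pi.single c 1) ⬝ᵥ (Φ *ᵥ Pi.single c 1) = 1 := fun c => by
    simpa [dotProduct_self_eq_sum_sq] using hcols c
  have hcard : (insert j' S0).card ≤ K := by
    rw [Finset.card_insert_of_notMem hj']; omega
  set M := S0.sup' hne (fun i => |x0 i|) with hM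
  have hxM : ∀ i ∈ S0, |x0 i| ≤ M := fun i hi => Finset.le_sup' (fun i => |x0 i|) hi
  have hM0 : 0 ≤ M := (abs_nonneg _).trans (hxM j hj0)
  -- the part of `x0` supported off `S`, with and without the coordinate `j`
  set u : Fin N → ℝ := fun i => if i ∈ S then 0 else x0 i with hu
  set b : Fin N → ℝ := fun i => if i = j then 0 else u i with hb
  have hunorm : u ⬝ᵥ u ≤ K / 2 * M ^ 2 := by
    rw [dotProduct_self_eq_sum_sq, ← Finset.sum_subset (Finset.subset_univ S0)
      (fun i _ hi => by simp [hu, hsupp i hi])]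
    have h1 : ∑ i ∈ S0, u i ^ 2 ≤ S0.card • M ^ 2 := Finset.sum_le_card_nsmul _ _ _ fun i hi => by
      by_cases hiS : i ∈ S
      · simpa [hu, hiS] using sq_nonneg M
      · simpa [hu, hiS] using pow_le_pow_left₀ (abs_nonneg _) (hxM i hi) 2
    have h2 : (2 : ℝ) * S0.card ≤ K := by exact_mod_cast hS0card
    rw [nsmul_eq_mul] at h1
    nlinarith [sq_nonneg M]
  have hbnorm : b ⬝ᵥ b ≤ K / 2 * M ^ 2 := by
    refine le_trans ?_ hunorm
    rw [dotProduct_self_eq_sum_sq, dotProduct_self_eq_sum_sq]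
    refine Finset.sum_le_sum fun i _ => ?_
    by_cases hij : i = j
    · simpa [hb, hij] using sq_nonneg (u j)
    · simp [hb, hij]
  have huS : ∀ i ∈ S, u i = 0 := fun i hi => by simp [hu, hi]
  have hbS : ∀ i ∈ S, b i = 0 := fun i hi => by simp [hb, huS i hi]
  have hu0 : ∀ i ∉ S0, u i = 0 := fun i hi => by simp [hu, hsupp i hi]
  have hb0 : ∀ i ∉ S0, b i = 0 := fun i hi => by simp [hb, hu0 i hi]
  have hu_split : u = x0 j • Pi.single j 1 + b := by
    ext i
    by_cases hij : i = j
    · subst hij; simp [hb, hu, hjS]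
    · simp [hb, hij]
  -- both cross terms are at most `δ * √(K / 2) * M`
  have hcross : ∀ c ∈ insert j' S0, c ∉ S → ∀ v : Fin N → ℝ, (∀ i ∈ S, v i = 0) →
      (∀ i ∉ S0, v i = 0) → v c = 0 → v ⬝ᵥ v ≤ K / 2 * M ^ 2 →
      |(Φ *ᵥ Pi.single c 1) ⬝ᵥ Q *ᵥ (Φ *ᵥ v)| ≤ δ * (√(K / 2) * M) := by
    intro c hc hcS v hvS hv0 hvc hv
    have h := hQ.sq_bilin_le hR hδ1 (T := insert j' S0) (a := Pi.single c 1) (b := v)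
      (by rwa [Finset.union_eq_left.2 (hSS.1.trans (Finset.subset_insert _ _))])
      (fun i hi => Pi.single_eq_of_ne (ne_of_mem_of_not_mem hc hi).symm _)
      (fun i hi => Pi.single_eq_of_ne (ne_of_mem_of_not_mem hi hcS) _)
      (fun i hi => hv0 i fun h => hi (Finset.mem_insert_of_mem h)) hvS (by simp [hvc])
    refine abs_le_of_sq_le_sq (h.trans ?_) (by positivity)
    rw [mul_pow, mul_pow, Real.sq_sqrt (by positivity)]
    refine mul_le_mul_of_nonneg_left ?_ (sq_nonneg δ)
    simpa using hv
  have hn : √(nv ⬝ᵥ nv) ≤ ε := by rwa [dotProduct_self_eq_sum_sq]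
  have hcorr : ∀ c, |∑ i, Φ i c * lsResidual Φ S y i|
      = |(Φ *ᵥ Pi.single c 1) ⬝ᵥ Q *ᵥ (Φ *ᵥ u)
          + (Φ *ᵥ Pi.single c 1) ⬝ᵥ Q *ᵥ nv| := by
    intro c
    have hx : x0 = u + (x0 - u) := by abel
    have hker := hQ.mulVec_eq_zero (x0 - u) fun i hi => by simp [hu, hi]
    have hy' : Q *ᵥ y = Q *ᵥ (Φ *ᵥ u) + Q *ᵥ nv := by
      rw [hy, ← hy0, hx, mulVec_add, mulVec_add, mulVec_add, hker, add_zero]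
    rw [hres, ← dotProduct_add, ← hy', ← abs_neg]
    simp [dotProduct]
  have hoff := hcross j' (Finset.mem_insert_self _ _) hj'S u huS hu0 (hu0 j' hj') hunorm
  have hon := hcross j (Finset.mem_insert_of_mem hj0) hjS b hbS hb0 (by simp [hb]) hbnorm
  have hnoff := hQ.abs_dotProduct_mulVec_le (hcol j') hn
  have hnon := hQ.abs_dotProduct_mulVec_le (hcol j) hn
  have hself := hQ.one_sub_sq_le hR hδ0 hδ1 hjS
    ((Finset.card_le_card (t := insert j' S0) (by
      intro i hi
      rcases Finset.mem_union.1 hi with h | h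
      · exact Finset.mem_insert_of_mem (Finset.mem_singleton.1 h ▸ hj0)
      · exact Finset.mem_insert_of_mem (hSS.1 h))).trans hcard) (hcol j)
  have hε : 0 ≤ ε := (Real.sqrt_nonneg _).trans hn
  have hdynj : 2 * (ε + δ / (1 - δ) * √(K / 2) * M) ≤ |x0 j| :=
    hdyn.le.trans (Finset.inf'_le _ hj0)
  have hroot : 1 ≤ √((K : ℝ) / 2) := Real.one_le_sqrt.2 (by
    have : (2 : ℝ) ≤ K := by exact_mod_cast hK2
    linarith)
  have hlt : 0 < 1 - δ := by linarith
  set R := √((K : ℝ) / 2) * M with hRdef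
  have hRM : M ≤ R := le_mul_of_one_le_left hM0 hroot
  have hgap : 2 * (δ * R + ε) ≤ (1 - δ ^ 2) * |x0 j| := by
    have h1 : δ / (1 - δ) * √(K / 2) * M * (1 - δ) = δ * R := by
      rw [hRdef]; field_simp
    have h2 : 2 * (ε * (1 - δ) + δ * R) ≤ (1 - δ) * |x0 j| := by nlinarith
    have h3 : 2 * ε ≤ R := by
      have : 0 ≤ δ / (1 - δ) * √(K / 2) * M := by positivity
      have := hxM j hj0
      linarith
    nlinarith [mul_le_mul_of_nonneg_left h2 (by linarith : 0 ≤ 1 + δ),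
      mul_le_mul_of_nonneg_left h3 (sq_nonneg δ)]
  rw [hcorr, hcorr]
  refine (abs_add_le _ _).trans ((add_le_add hoff hnoff).trans ?_)
  rw [hu_split, mulVec_add, mulVec_add, mulVec_smul, mulVec_smul, dotProduct_add,
    dotProduct_smul, smul_eq_mul]
  set s := (Φ *ᵥ Pi.single j 1) ⬝ᵥ Q *ᵥ (Φ *ᵥ Pi.single j 1) with hs
  have hmain : (1 - δ ^ 2) * |x0 j| ≤ |x0 j * s| := by
    rw [abs_mul, mul_comm]
    exact mul_le_mul_of_nonneg_left (hself.trans (le_abs_self s)) (abs_nonneg _)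
  have h1 := abs_sub_abs_le_abs_add (x0 j * s) ((Φ *ᵥ Pi.single j 1) ⬝ᵥ Q *ᵥ (Φ *ᵥ b))
  have h2 := abs_sub_abs_le_abs_add (x0 j * s + (Φ *ᵥ Pi.single j 1) ⬝ᵥ Q *ᵥ (Φ *ᵥ b))
    ((Φ *ᵥ Pi.single j 1) ⬝ᵥ Q *ᵥ nv)
  linarith
end
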